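/- Fix integers 1 ≤ r ≤ k, points θ₀, d, w ∈ ℝ^k and a real ε ≥ 0; set d_ε = d + ε·w. Let m : ℝ^k → ℝ^r be continuously differentiable with m(θ₀) = 0, let Σ₀ be a symmetric positive definite k×k matrix with M₀ᵀ Σ₀ M₀ invertible, where M₀ = M(θ₀), and set N₀ = M₀ (M₀ᵀ Σ₀ M₀)⁻¹ M₀ᵀ, λ* = d_εᵀ N₀ d_ε. Let θ*_n ∈ ℝ^k be a deterministic sequence with √n·(θ*_n − θ₀) → d_ε, and for each n let θ̂_n be a random vector and Σ_n a random symmetric k×k matrix on a probability space (Ω_n, P_n) such that √n·(θ̂_n − θ*_n) converges in distribution to N(0, Σ₀) and Σ_n converges in probability to Σ₀. Then for every t ∈ ℝ, lim_{n→∞} P_n(W_n > t) = Σ_{v=0}^∞ e^{−λ*/2}·(λ*/2)^v / v! · χ²_{r+2v}((t, ∞)), where W_n = n · m(θ̂_n)ᵀ (M(θ̂_n)ᵀ Σ_n M(θ̂_n))⁻¹ m(θ̂_n) and χ²_k denotes the chi-square distribution with k degrees of freedom. -/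

import Mathlib

open MeasureTheory ProbabilityTheory Filter Matrix Topology

noncomputable section

/-- The `m`-fold product of standard real Gaussian measures on `Fin m → ℝ`. -/
def stdGaussianPi (m : ℕ) : Measure (Fin m → ℝ) :=
  Measure.pi fun _ => gaussianReal 0 1

/-- `ν` is the multivariate normal distribution `N(0, V)` on `ℝ^m`: the pushforward of the
`m`-fold product of standard real Gaussians under a linear map `L` with `L * Lᵀ = V`. -/
def IsMVNormal (m : ℕ) (V : Matrix (Fin m) (Fin m) ℝ) (ν : Measure (Fin m → ℝ)) : Prop :=
  ∃ L : Matrix (Fin m) (Fin m) ℝ, L * Lᵀ = V ∧ ν = (stdGaussianPi m).map L.mulVec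

/-- Convergence in distribution of random elements `X n`, each defined on its own probability
space `(Ω n, P n)`, to the probability measure `ν`: weak convergence of the pushforwards. -/
def TendstoInDistribution {Ω : ℕ → Type*} [∀ n, MeasurableSpace (Ω n)]
    (P : ∀ n, Measure (Ω n)) {E : Type*} [MeasurableSpace E] [TopologicalSpace E]
    (X : ∀ n, Ω n → E) (ν : Measure E) : Prop :=
  ∀ f : BoundedContinuousFunction E ℝ,
    Tendsto (fun n => ∫ ω, f (X n ω) ∂ (P n)) atTop (𝓝 (∫ x, f x ∂ ν))

/-- Convergence in probability to a constant. -/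
def TendstoInProbability {Ω : ℕ → Type*} [∀ n, MeasurableSpace (Ω n)]
    (P : ∀ n, Measure (Ω n)) {E : Type*} [NormedAddCommGroup E]
    (X : ∀ n, Ω n → E) (y : E) : Prop :=
  ∀ η : ℝ, 0 < η → Tendsto (fun n => P n {ω | η < ‖X n ω - y‖}) atTop (𝓝 0)

/-- The chi-square distribution with `k` degrees of freedom: Gamma with shape `k/2`, rate `1/2`. -/
def chiSq (k : ℕ) : Measure ℝ := gammaMeasure ((k : ℝ) / 2) (1 / 2)

/-- The `k × r` matrix `M(θ)` with entries `M(θ)_{ij} = ∂ m_j (θ) / ∂ θ_i`. -/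
def jacM {k r : ℕ} (m : (Fin k → ℝ) → Fin r → ℝ) (θ : Fin k → ℝ) :
    Matrix (Fin k) (Fin r) ℝ :=
  Matrix.of fun i j => fderiv ℝ m θ (Pi.single i 1) j

/-- The Wald-type test statistic
`W_n = n · m(θ̂)ᵀ (M(θ̂)ᵀ Σ M(θ̂))⁻¹ m(θ̂)`. -/
def waldStat {k r : ℕ} (m : (Fin k → ℝ) → Fin r → ℝ) (n : ℕ)
    (θhat : Fin k → ℝ) (S : Matrix (Fin k) (Fin k) ℝ) : ℝ :=
  (n : ℝ) * (m θhat ⬝ᵥ ((jacM m θhat)ᵀ * S * jacM m θhat)⁻¹.mulVec (m θhat))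


lemma map_mulVec_pi_gaussianReal {k r : ℕ} (C : Matrix (Fin r) (Fin k) ℝ) (hC : C * Cᵀ = 1) :
    (Measure.pi fun _ : Fin k => gaussianReal 0 1).map C.mulVec =
      Measure.pi fun _ : Fin r => gaussianReal 0 1 := by
  have hmeas : Measurable C.mulVec := (Continuous.matrix_mulVec continuous_const continuous_id).measurable
  have : IsProbabilityMeasure ((Measure.pi fun _ : Fin k => gaussianReal 0 1).map C.mulVec) :=
    Measure.isProbabilityMeasure_map hmeas.aemeasurable
  refine Measure.ext_of_charFunDual (funext fun L => ?_)
  let T : (Fin k → ℝ) →L[ℝ] (Fin r → ℝ) := LinearMap.toContinuousLinearMap C.mulVecLin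
  have hT : C.mulVec = T := rfl
  have h1 : ∀ (n : ℕ) (L : StrongDual ℝ (Fin n → ℝ)),
      charFunDual (Measure.pi fun _ : Fin n => gaussianReal 0 1) L =
        Complex.exp (-(((fun i => L (Pi.single i 1)) ⬝ᵥ (fun i => L (Pi.single i 1)) : ℝ) : ℂ) / 2) := by
    intro n L
    rw [charFunDual_pi]
    have h2 : ∀ i, charFunDual (gaussianReal 0 1) (L.comp (.single ℝ (fun _ => ℝ) i)) =
        Complex.exp (-((L (Pi.single i 1)) ^ 2 : ℝ) / 2) := by
      intro i
      rw [charFunDual_apply]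
      have h3 : ∀ x : ℝ, L.comp (.single ℝ (fun _ => ℝ) i) x = L (Pi.single i 1) * x := by
        intro x
        rw [mul_comm, ← smul_eq_mul, ← map_smul, ← Pi.single_smul, smul_eq_mul, mul_one]
        rfl
      simp_rw [h3, Complex.ofReal_mul, ← charFun_apply_real, charFun_gaussianReal]
      simp [neg_div]
    simp_rw [h2, ← Complex.exp_sum]
    congr 1
    simp [dotProduct, ← Finset.sum_div, ← pow_two]
  rw [hT, charFunDual_map, h1, h1]
  have h3 : (fun i => (L.comp T) (Pi.single i 1)) =
      Cᵀ.mulVec (fun i => L (Pi.single i 1)) := by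
    ext j
    have : T (Pi.single j 1) = ∑ i, C i j • Pi.single i (1 : ℝ) := by
      ext i
      simp [T, Finset.sum_apply, Pi.single_apply]
    simp only [ContinuousLinearMap.comp_apply, this, map_sum, map_smul]
    simp [mulVec, dotProduct]
  rw [h3, dotProduct_mulVec, vecMul_transpose, mulVec_mulVec, hC, one_mulVec]

lemma mgf_gammaMeasure {a s : ℝ} (ha : 0 < a) (hs : s < 1 / 2) :
    mgf id (gammaMeasure a (1 / 2)) s = (1 - 2 * s) ^ (-a) := by
  have h0 : (0 : ℝ) < 1 / 2 - s := by linarith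
  have hG := Real.Gamma_pos_of_pos ha
  rw [mgf, gammaMeasure, integral_withDensity_eq_integral_toReal_smul
    (by unfold gammaPDF; exact (measurable_gammaPDFReal a _).ennreal_ofReal)
    (ae_of_all _ fun x => by simp [gammaPDF])]
  have h1 : ∀ x : ℝ, (gammaPDF a (1 / 2) x).toReal • Real.exp (s * id x) =
      (Set.Ici (0 : ℝ)).indicator (fun x => ((1 / 2) ^ a / Real.Gamma a) *
        (x ^ (a - 1) * Real.exp (-((1 / 2 - s) * x)))) x := by
    intro x
    rw [gammaPDF, ENNReal.toReal_ofReal (gammaPDFReal_nonneg ha (by norm_num) x), gammaPDFReal]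
    by_cases hx : 0 ≤ x
    · rw [if_pos hx, Set.indicator_of_mem (by simpa using hx), smul_eq_mul, id, mul_assoc, ← Real.exp_add]
      rw [show -(1 / 2 * x) + s * x = -((1 / 2 - s) * x) by ring]
      ring
    · rw [if_neg hx, Set.indicator_of_notMem (by simpa using hx)]
      simp
  simp_rw [h1]
  rw [integral_indicator measurableSet_Ici, integral_Ici_eq_integral_Ioi, integral_const_mul,
    Real.integral_rpow_mul_exp_neg_mul_Ioi ha h0]
  rw [Real.rpow_neg (by linarith), show (1 - 2 * s) = (1 / 2 - s) / (1 / 2) by ring,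
    Real.div_rpow h0.le (by norm_num), Real.div_rpow zero_le_one h0.le, Real.one_rpow]
  field_simp

lemma charFun_gammaMeasure {a : ℝ} (ha : 0 < a) (t : ℝ) :
    charFun (gammaMeasure a (1 / 2)) t = (1 - 2 * (t * Complex.I)) ^ (-a : ℂ) := by
  have hint : Set.Iio (1 / 2 : ℝ) ⊆ interior (integrableExpSet id (gammaMeasure a (1 / 2))) := by
    refine interior_maximal (fun s hs => ?_) isOpen_Iio
    by_contra h
    have h1 := mgf_gammaMeasure ha hs
    rw [mgf, integral_undef h] at h1
    have : (0 : ℝ) < 1 - 2 * s := by simp only [Set.mem_Iio] at hs; linarith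
    exact (Real.rpow_pos_of_pos this _).ne h1
  set U : Set ℂ := {z | z.re < 1 / 2} with hU
  have hUo : IsOpen U := isOpen_lt Complex.continuous_re continuous_const
  have hUc : IsPreconnected U := (convex_halfSpace_re_lt _).isPreconnected
  have hf : AnalyticOnNhd ℂ (complexMGF id (gammaMeasure a (1 / 2))) U :=
    (differentiableOn_complexMGF.mono fun z hz => hint hz).analyticOnNhd hUo
  have hg : AnalyticOnNhd ℂ (fun z : ℂ => (1 - 2 * z) ^ (-a : ℂ)) U := by
    refine DifferentiableOn.analyticOnNhd (fun z hz => ?_) hUo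
    refine DifferentiableAt.differentiableWithinAt ?_
    refine DifferentiableAt.cpow_const (by fun_prop) (Or.inl ?_)
    simp only [hU, Set.mem_ofPred_eq] at hz
    simp; linarith
  have h0 : (0 : ℂ) ∈ U := by simp [hU]
  have hlim : Tendsto (fun x : ℝ => (x : ℂ)) (𝓝[≠] 0) (𝓝[≠] 0) := by
    refine tendsto_nhdsWithin_iff.2 ⟨?_, ?_⟩
    · exact (Complex.continuous_ofReal.tendsto' 0 0 (by simp)).mono_left nhdsWithin_le_nhds
    · filter_upwards [self_mem_nhdsWithin] with x hx
      simpa using hx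
  have hfreq : ∃ᶠ z in 𝓝[≠] (0 : ℂ), complexMGF id (gammaMeasure a (1 / 2)) z =
      (1 - 2 * z) ^ (-a : ℂ) := by
    refine hlim.frequently (Eventually.frequently ?_)
    filter_upwards [nhdsWithin_le_nhds (Iio_mem_nhds (show (0 : ℝ) < 1 / 2 by norm_num))] with x hx
    rw [complexMGF_ofReal, mgf_gammaMeasure ha hx, Complex.ofReal_cpow (by simp only [Set.mem_Iio] at hx; linarith)]
    push_cast
    rfl
  have := hf.eqOn_of_preconnected_of_frequently_eq hg hUc h0 hfreq
    (show (t * Complex.I : ℂ) ∈ U by simp [hU])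
  rw [← complexMGF_id_mul_I]
  exact this

lemma charFun_map_add_sq_gaussianReal (μ t : ℝ) :
    ∫ x : ℝ, Complex.exp (t * ((μ + x) ^ 2 : ℝ) * Complex.I) ∂(gaussianReal 0 1) =
      (1 - 2 * (t * Complex.I)) ^ (-(1 / 2) : ℂ) *
        Complex.exp (μ ^ 2 * (t * Complex.I) / (1 - 2 * (t * Complex.I))) := by
  rw [integral_gaussianReal_eq_integral_smul one_ne_zero]
  set z : ℂ := t * Complex.I with hz
  have hzre : z.re = 0 := by simp [hz]
  have h1 : ∀ x : ℝ, gaussianPDFReal 0 1 x • Complex.exp (t * ((μ + x) ^ 2 : ℝ) * Complex.I) =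
      ((√(2 * Real.pi))⁻¹ : ℝ) *
        Complex.exp ((z - 1 / 2) * x ^ 2 + (2 * μ * z) * x + μ ^ 2 * z) := by
    intro x
    rw [gaussianPDFReal, Complex.real_smul, hz]
    push_cast
    rw [mul_assoc, ← Complex.exp_add]
    simp only [mul_one]
    congr 2
    ring
  simp_rw [h1]
  rw [integral_const_mul, integral_cexp_quadratic (by simp [hzre])]
  have hne : (1 - 2 * z) ≠ 0 := by
    intro h
    have := congrArg Complex.re h
    simp [hzre] at this
  rw [← mul_assoc]
  congr 1
  · rw [show (Real.pi / -(z - 1 / 2) : ℂ) = ((2 * Real.pi : ℝ) : ℂ) * (1 - 2 * z)⁻¹ by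
      push_cast
      have : -(z - 1 / 2) = (1 - 2 * z) / 2 := by ring
      rw [this]; field_simp]
    have harg : (1 - 2 * z).arg ≠ Real.pi := by
      intro h
      have := (Complex.arg_eq_pi_iff.1 h).1
      simp [hzre] at this
      linarith
    have hpi : (0 : ℝ) < 2 * Real.pi := by positivity
    have h2 : ((2 * Real.pi : ℝ) : ℂ) ≠ 0 := by exact_mod_cast hpi.ne'
    rw [Complex.cpow_def_of_ne_zero (mul_ne_zero h2 (inv_ne_zero hne)),
      Complex.log_ofReal_mul hpi (inv_ne_zero hne), add_mul, Complex.exp_add,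
      ← Complex.cpow_def_of_ne_zero (inv_ne_zero hne), Complex.inv_cpow _ _ harg,
      ← Complex.cpow_neg, ← mul_assoc, Complex.ofReal_log hpi.le,
      ← Complex.cpow_def_of_ne_zero h2, Real.sqrt_eq_rpow, Complex.ofReal_inv,
      Complex.ofReal_cpow hpi.le]
    rw [show ((1 / 2 : ℝ) : ℂ) = 1 / 2 by push_cast; rfl, inv_mul_cancel₀, one_mul]
    rw [Ne, Complex.cpow_eq_zero_iff]
    tauto
  · congr 1
    obtain ⟨w, hw⟩ : ∃ w, w = 1 - 2 * z := ⟨_, rfl⟩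
    rw [← hw] at hne ⊢
    rw [show z = (1 - w) / 2 by rw [hw]; ring, show (1 - w) / 2 - 1 / 2 = -(w / 2) by ring]
    field_simp
    ring

lemma charFun_map_dotProduct_self_pi_gaussianReal {r : ℕ} (μ : Fin r → ℝ) (t : ℝ) :
    charFun ((Measure.pi fun _ : Fin r => gaussianReal 0 1).map
        (fun u => (μ + u) ⬝ᵥ (μ + u))) t =
      (1 - 2 * (t * Complex.I)) ^ (-(r / 2) : ℂ) *
        Complex.exp ((μ ⬝ᵥ μ : ℝ) * (t * Complex.I) / (1 - 2 * (t * Complex.I))) := by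
  have hm : Measurable (fun u : Fin r → ℝ => (μ + u) ⬝ᵥ (μ + u)) := by
    unfold dotProduct
    fun_prop
  rw [charFun_apply_real, integral_map hm.aemeasurable (by fun_prop)]
  have h1 : ∀ u : Fin r → ℝ, Complex.exp (t * ((μ + u) ⬝ᵥ (μ + u) : ℝ) * Complex.I) =
      ∏ i, Complex.exp (t * ((μ i + u i) ^ 2 : ℝ) * Complex.I) := by
    intro u
    rw [← Complex.exp_sum]
    congr 1
    simp only [dotProduct, Pi.add_apply, Complex.ofReal_sum, Finset.mul_sum, Finset.sum_mul, pow_two]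
  simp_rw [h1]
  rw [integral_fintype_prod_eq_prod
    (f := fun i x => Complex.exp (t * ((μ i + x) ^ 2 : ℝ) * Complex.I))]
  simp_rw [charFun_map_add_sq_gaussianReal]
  rw [Finset.prod_mul_distrib, ← Complex.exp_sum, Finset.prod_const, ← Complex.cpow_nat_mul]
  congr 2
  · simp
    ring
  · simp only [dotProduct, Complex.ofReal_sum, Finset.sum_mul, Finset.sum_div, Complex.ofReal_mul,
      pow_two]

/-- The Poisson mixture of chi-square distributions, i.e. the noncentral chi-square distribution
with `r` degrees of freedom and noncentrality parameter `l`. -/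
def noncentralChiSq (r : ℕ) (l : ℝ) : Measure ℝ :=
  Measure.sum fun v : ℕ =>
    ENNReal.ofReal (Real.exp (-l / 2) * (l / 2) ^ v / (Nat.factorial v)) • chiSq (r + 2 * v)

lemma isProbabilityMeasure_chiSq {n : ℕ} (hn : 0 < n) : IsProbabilityMeasure (chiSq n) :=
  isProbabilityMeasure_gammaMeasure (by positivity) (by norm_num)

lemma isProbabilityMeasure_noncentralChiSq {r : ℕ} (hr : 0 < r) {l : ℝ} (hl : 0 ≤ l) :
    IsProbabilityMeasure (noncentralChiSq r l) := by
  refine ⟨?_⟩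
  have h1 : ∀ v : ℕ, chiSq (r + 2 * v) Set.univ = 1 := fun v =>
    (isProbabilityMeasure_chiSq (by omega)).measure_univ
  have h2 : HasSum (fun v : ℕ => Real.exp (-l / 2) * (l / 2) ^ v / (Nat.factorial v)) 1 := by
    have := (NormedSpace.expSeries_div_hasSum_exp (l / 2)).mul_left (Real.exp (-l / 2))
    rw [← Real.exp_eq_exp_ℝ, ← Real.exp_add] at this
    simpa [mul_div_assoc, neg_div] using this
  simp only [noncentralChiSq, Measure.sum_apply _ MeasurableSet.univ, Measure.smul_apply, h1,
    smul_eq_mul, mul_one]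
  rw [← ENNReal.ofReal_tsum_of_nonneg (fun v => by positivity) h2.summable, h2.tsum_eq,
    ENNReal.ofReal_one]

lemma charFun_noncentralChiSq {r : ℕ} (hr : 0 < r) {l : ℝ} (hl : 0 ≤ l) (t : ℝ) :
    charFun (noncentralChiSq r l) t =
      (1 - 2 * (t * Complex.I)) ^ (-(r / 2) : ℂ) *
        Complex.exp (l * (t * Complex.I) / (1 - 2 * (t * Complex.I))) := by
  have := isProbabilityMeasure_noncentralChiSq hr hl
  set z : ℂ := t * Complex.I with hz
  have hne : (1 - 2 * z) ≠ 0 := by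
    intro h
    have := congrArg Complex.re h
    simp [hz] at this
  have hint : Integrable (fun x : ℝ => Complex.exp (t * x * Complex.I)) (noncentralChiSq r l) := by
    refine Integrable.of_bound (by fun_prop) 1 (ae_of_all _ fun x => ?_)
    rw [← Complex.ofReal_mul, Complex.norm_exp_ofReal_mul_I]
  have h1 := hasSum_integral_measure hint
  rw [← noncentralChiSq, ← charFun_apply_real] at h1
  refine h1.unique ?_
  have h2 := ((NormedSpace.expSeries_div_hasSum_exp ((l / 2) * (1 - 2 * z)⁻¹)).mul_left
    (Complex.exp (-l / 2))).mul_left ((1 - 2 * z) ^ (-(r / 2) : ℂ))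
  rw [← Complex.exp_eq_exp_ℂ, ← Complex.exp_add] at h2
  convert h2 using 1
  · rfl
  · funext v
    rw [integral_smul_measure, ← charFun_apply_real, chiSq, charFun_gammaMeasure (by positivity),
      ENNReal.toReal_ofReal (by positivity)]
    rw [show (-(((r + 2 * v : ℕ) : ℝ) / 2 : ℝ) : ℂ) = -(r / 2) + -(v : ℂ) by push_cast; ring,
      ← hz, Complex.cpow_add _ _ hne, Complex.cpow_neg _ (v : ℂ), Complex.cpow_natCast,
      Complex.real_smul, mul_pow, inv_pow]
    push_cast
    ring
  · congr 2
    obtain ⟨w, hw⟩ : ∃ w, w = 1 - 2 * z := ⟨_, rfl⟩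
    rw [← hw] at hne ⊢
    rw [show z = (1 - w) / 2 by rw [hw]; ring]
    field_simp
    ring

lemma map_dotProduct_self_pi_gaussianReal {r : ℕ} (hr : 0 < r) (μ : Fin r → ℝ) :
    (Measure.pi fun _ : Fin r => gaussianReal 0 1).map (fun u => (μ + u) ⬝ᵥ (μ + u)) =
      noncentralChiSq r (μ ⬝ᵥ μ) := by
  have hm : Measurable (fun u : Fin r → ℝ => (μ + u) ⬝ᵥ (μ + u)) := by
    unfold dotProduct
    fun_prop
  have hl : 0 ≤ μ ⬝ᵥ μ := by
    simpa [dotProduct] using Finset.sum_nonneg fun i _ => mul_self_nonneg (μ i)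
  have := isProbabilityMeasure_noncentralChiSq hr hl
  have := Measure.isProbabilityMeasure_map (μ := Measure.pi fun _ : Fin r => gaussianReal 0 1)
    hm.aemeasurable
  refine Measure.ext_of_charFun (funext fun t => ?_)
  rw [charFun_map_dotProduct_self_pi_gaussianReal, charFun_noncentralChiSq hr hl]

lemma noncentralChiSq_singleton (r : ℕ) (l x : ℝ) : noncentralChiSq r l {x} = 0 := by
  rw [noncentralChiSq, Measure.sum_apply _ (measurableSet_singleton x)]
  have h : ∀ n : ℕ, chiSq n {x} = 0 := fun n =>
    (withDensity_absolutelyContinuous _ _) (by simp)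
  simp [h]

section ExtendedSlutsky

variable {Ω : ℕ → Type} [∀ n, MeasurableSpace (Ω n)] {P : ∀ n, Measure (Ω n)}
  {k : ℕ} {X : ∀ n, Ω n → Fin k → ℝ} {ν : Measure (Fin k → ℝ)}

/-- Weak convergence, tested with Bochner integrals, forces the random vectors to be eventually
a.e. measurable. -/
lemma eventually_aemeasurable_of_tendstoInDistribution [IsProbabilityMeasure ν]
    (h : _root_.TendstoInDistribution P X ν) : ∀ᶠ n in atTop, AEMeasurable (X n) (P n) := by
  simp_rw [aemeasurable_pi_iff]
  rw [eventually_all]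
  intro i
  have hlow : ∀ y : ℝ, 0 < 2 + Real.arctan y := fun y => by
    linarith [Real.neg_pi_div_two_lt_arctan y, Real.pi_lt_four]
  have hup : ∀ y : ℝ, 2 + Real.arctan y ≤ 4 := fun y => by
    linarith [Real.arctan_lt_pi_div_two y, Real.pi_lt_four]
  let f : BoundedContinuousFunction (Fin k → ℝ) ℝ :=
    BoundedContinuousFunction.ofNormedAddCommGroup (fun x => 2 + Real.arctan (x i))
      (by fun_prop) 4 (fun x => by
        rw [Real.norm_of_nonneg (hlow _).le]
        exact hup _)
  have hf : ∀ x, f x = 2 + Real.arctan (x i) := fun x => rfl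
  have hpos : 0 < ∫ x, f x ∂ν := by
    rw [integral_pos_iff_support_of_nonneg (f := f) (fun x => (hlow _).le) (f.integrable ν)]
    have : Function.support f = Set.univ := by
      ext x
      simpa [hf] using (hlow (x i)).ne'
    simp [this]
  filter_upwards [(h f).eventually (lt_mem_nhds hpos)] with n hn
  have hi : Integrable (fun ω => f (X n ω)) (P n) := by
    by_contra hc
    rw [integral_undef hc] at hn
    exact lt_irrefl _ hn
  have h2 : (fun ω => X n ω i) =
      (fun y => Real.sin (y - 2) / Real.cos (y - 2)) ∘ fun ω => f (X n ω) := by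
    funext ω
    simp only [Function.comp, hf, add_sub_cancel_left]
    rw [← Real.tan_eq_sin_div_cos, Real.tan_arctan]
  rw [h2]
  exact Measurable.comp_aemeasurable (by fun_prop) hi.aemeasurable

variable [∀ n, IsProbabilityMeasure (P n)]

lemma limsup_measure_closed_le_of_tendstoInDistribution [IsProbabilityMeasure ν]
    (h : _root_.TendstoInDistribution P X ν) {F : Set (Fin k → ℝ)} (hF : IsClosed F) :
    limsup (fun n => P n {ω | X n ω ∈ F}) atTop ≤ ν F := by
  classical
  have hae := eventually_aemeasurable_of_tendstoInDistribution h
  let M : ℕ → Measure (Fin k → ℝ) := fun n =>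
    if AEMeasurable (X n) (P n) then (P n).map (X n) else ν
  have hM : ∀ n, IsProbabilityMeasure (M n) := by
    intro n
    by_cases hn : AEMeasurable (X n) (P n)
    · simpa only [M, if_pos hn] using Measure.isProbabilityMeasure_map hn
    · simpa only [M, if_neg hn]
  have hMmap : ∀ᶠ n in atTop, M n = (P n).map (X n) := hae.mono fun n hn => if_pos hn
  let Q : ℕ → ProbabilityMeasure (Fin k → ℝ) := fun n => ⟨M n, hM n⟩
  let ν' : ProbabilityMeasure (Fin k → ℝ) := ⟨ν, inferInstance⟩
  have hlim : Tendsto Q atTop (𝓝 ν') := by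
    rw [ProbabilityMeasure.tendsto_iff_forall_integral_tendsto]
    intro f
    refine (h f).congr' ?_
    filter_upwards [hae, hMmap] with n hn hn'
    change _ = ∫ x, f x ∂(M n)
    rw [hn', integral_map hn f.continuous.aestronglyMeasurable]
  refine le_of_eq_of_le (limsup_congr ?_)
    (ProbabilityMeasure.limsup_measure_closed_le_of_tendsto hlim hF)
  filter_upwards [hae, hMmap] with n hn hn'
  change _ = M n F
  rw [hn', Measure.map_apply_of_aemeasurable hn hF.measurableSet]
  rfl

/-- If `G n x s → q x` as `n → ∞`, locally uniformly in the sense that `x` and `s` may also vary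
near their limits, then super-level events of `G n (X n) (S n)` have asymptotic probability
at most that of the limiting closed event. -/
lemma limsup_measure_le_of_continuous_convergence [IsProbabilityMeasure ν]
    (h : _root_.TendstoInDistribution P X ν) {F : Type*} [NormedAddCommGroup F]
    {S : ∀ n, Ω n → F} {s₀ : F} (hS : TendstoInProbability P S s₀)
    {G : ℕ → (Fin k → ℝ) → F → ℝ} {q : (Fin k → ℝ) → ℝ} (hq : Continuous q)
    (hG : ∀ x, Tendsto (fun p : (ℕ × F) × (Fin k → ℝ) => G p.1.1 p.2 p.1.2)
      ((atTop ×ˢ 𝓝 s₀) ×ˢ 𝓝 x) (𝓝 (q x)))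
    {A : Set ℝ} (hA : IsOpen A) :
    limsup (fun n => P n {ω | G n (X n ω) (S n ω) ∉ A}) atTop ≤ ν {x | q x ∉ A} := by
  have hU : IsOpen {x | q x ∈ A} := hA.preimage hq
  have key : ∀ K ⊆ {x | q x ∈ A}, IsCompact K →
      limsup (fun n => P n {ω | G n (X n ω) (S n ω) ∉ A}) atTop ≤ ν Kᶜ := by
    intro K hKU hK
    obtain ⟨L, hL, hKL, hLU⟩ := exists_compact_between hK hU hKU
    have hev : ∀ᶠ p in atTop ×ˢ 𝓝 s₀, ∀ x ∈ L, G p.1 x p.2 ∈ A := by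
      have h1 : ∀ᶠ p in (atTop ×ˢ 𝓝 s₀) ×ˢ 𝓝ˢ L,
          G (Prod.fst (Prod.fst p)) (Prod.snd p) (Prod.snd (Prod.fst p)) ∈ A := by
        rw [hL.prod_nhdsSet_eq_biSup]
        simp only [eventually_iSup]
        exact fun x hx => (hG x).eventually (hA.mem_nhds (hLU hx))
      obtain ⟨a, ha, b, hb, hab⟩ := eventually_prod_iff.1 h1
      filter_upwards [ha] with p hp x hx
      exact hab hp (hb.self_of_nhdsSet x hx)
    obtain ⟨a, ha, b, hb, hab⟩ := eventually_prod_iff.1 hev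
    obtain ⟨δ, hδ, hδb⟩ := Metric.eventually_nhds_iff.1 hb
    have hbad := hS (δ / 2) (half_pos hδ)
    have hle : ∀ᶠ n in atTop, P n {ω | G n (X n ω) (S n ω) ∉ A} ≤
        P n {ω | X n ω ∈ (interior L)ᶜ} + P n {ω | δ / 2 < ‖S n ω - s₀‖} := by
      filter_upwards [ha] with n hn
      refine (measure_mono fun ω hω => ?_).trans (measure_union_le _ _)
      by_contra hc
      simp only [Set.mem_union, not_or, Set.mem_ofPred_eq, Set.mem_compl_iff, not_not, not_lt] at hc
      refine hω (hab hn (hδb ?_) _ (interior_subset hc.1))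
      rw [dist_eq_norm]
      linarith [hc.2]
    calc limsup (fun n => P n {ω | G n (X n ω) (S n ω) ∉ A}) atTop
        ≤ limsup (fun n => P n {ω | X n ω ∈ (interior L)ᶜ} +
            P n {ω | δ / 2 < ‖S n ω - s₀‖}) atTop := limsup_le_limsup hle
      _ ≤ ν (interior L)ᶜ := by
          refine (ENNReal.limsup_add_of_right_tendsto_zero hbad
            (fun n => P n {ω | X n ω ∈ (interior L)ᶜ})).le.trans ?_
          exact limsup_measure_closed_le_of_tendstoInDistribution h isOpen_interior.isClosed_compl
      _ ≤ ν Kᶜ := by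
          exact measure_mono (Set.compl_subset_compl.2 hKL)
  have hcompl : {x | q x ∉ A} = {x | q x ∈ A}ᶜ := rfl
  rw [hcompl]
  refine ENNReal.le_of_forall_pos_le_add fun ε hε _ => ?_
  obtain ⟨K, hKU, hK, hKε⟩ := hU.measurableSet.exists_isCompact_sdiff_lt (μ := ν)
    (measure_ne_top _ _) (ENNReal.coe_pos.2 hε).ne'
  refine (key K hKU hK).trans ?_
  calc ν Kᶜ ≤ ν ({x | q x ∈ A}ᶜ ∪ ({x | q x ∈ A} \ K)) := by
        refine measure_mono fun x hx => ?_
        by_cases hxA : x ∈ {x | q x ∈ A}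
        · exact Or.inr ⟨hxA, hx⟩
        · exact Or.inl hxA
    _ ≤ _ := (measure_union_le _ _).trans (by gcongr)

lemma tendsto_measure_gt_of_continuous_convergence [IsProbabilityMeasure ν]
    (h : _root_.TendstoInDistribution P X ν) {F : Type*} [NormedAddCommGroup F]
    {S : ∀ n, Ω n → F} {s₀ : F} (hS : TendstoInProbability P S s₀)
    {G : ℕ → (Fin k → ℝ) → F → ℝ} {q : (Fin k → ℝ) → ℝ} (hq : Continuous q)
    (hG : ∀ x, Tendsto (fun p : (ℕ × F) × (Fin k → ℝ) => G p.1.1 p.2 p.1.2)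
      ((atTop ×ˢ 𝓝 s₀) ×ˢ 𝓝 x) (𝓝 (q x)))
    {t : ℝ} (ht : ν.map q {t} = 0) :
    Tendsto (fun n => P n {ω | t < G n (X n ω) (S n ω)}) atTop (𝓝 (ν.map q (Set.Ioi t))) := by
  have hqm := hq.measurable
  rw [Measure.map_apply hqm (measurableSet_singleton t)] at ht
  rw [Measure.map_apply hqm measurableSet_Ioi]
  have hup := limsup_measure_le_of_continuous_convergence h hS hq hG (isOpen_Iio (a := t))
  have hlo := limsup_measure_le_of_continuous_convergence h hS hq hG (isOpen_Ioi (a := t))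
  refine tendsto_of_le_liminf_of_limsup_le ?_ ?_
  · have h1 : ∀ n, 1 - P n {ω | G n (X n ω) (S n ω) ∉ Set.Ioi t} ≤
        P n {ω | t < G n (X n ω) (S n ω)} := by
      intro n
      rw [tsub_le_iff_right, ← measure_univ (μ := P n)]
      refine (measure_mono fun ω _ => ?_).trans (measure_union_le _ _)
      by_cases hω : t < G n (X n ω) (S n ω)
      · exact Or.inl hω
      · exact Or.inr hω
    refine le_trans ?_ (liminf_le_liminf (Eventually.of_forall h1))
    rw [ENNReal.liminf_const_sub _ _ ENNReal.one_ne_top]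
    refine le_trans ?_ (tsub_le_tsub_left hlo 1)
    rw [show {x | q x ∉ Set.Ioi t} = (q ⁻¹' Set.Ioi t)ᶜ from rfl,
      prob_compl_eq_one_sub (hqm measurableSet_Ioi),
      ENNReal.sub_sub_cancel ENNReal.one_ne_top prob_le_one]
  · refine (limsup_le_limsup (Eventually.of_forall fun n =>
      measure_mono fun ω hω => ?_)).trans (hup.trans ?_)
    · have hω' : t < G n (X n ω) (S n ω) := hω
      exact fun hc => lt_asymm hω' (Set.mem_Iio.1 hc)
    · calc ν {x | q x ∉ Set.Iio t} ≤ ν (q ⁻¹' Set.Ioi t ∪ q ⁻¹' {t}) := by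
            refine measure_mono fun x hx => ?_
            rcases (not_lt.1 hx : t ≤ q x).lt_or_eq with h1 | h1
            · exact Or.inl h1
            · exact Or.inr h1.symm
        _ ≤ _ := (measure_union_le _ _).trans (by rw [ht, add_zero])

end ExtendedSlutsky

lemma continuous_jacM {k r : ℕ} {m : (Fin k → ℝ) → Fin r → ℝ} (hm : ContDiff ℝ 1 m) :
    Continuous (jacM m) := by
  have h := hm.continuous_fderiv one_ne_zero
  refine continuous_matrix fun i j => ?_
  simp only [jacM, Matrix.of_apply]
  fun_prop

lemma jacM_transpose_mulVec {k r : ℕ} (m : (Fin k → ℝ) → Fin r → ℝ) (θ v : Fin k → ℝ) :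
    (jacM m θ)ᵀ.mulVec v = fderiv ℝ m θ v := by
  have hv : v = ∑ i, v i • Pi.single i (1 : ℝ) := by
    ext j
    simp [Finset.sum_apply, Pi.single_apply]
  conv_rhs => rw [hv, map_sum]
  ext j
  simp [mulVec, dotProduct, jacM, mul_comm, Finset.sum_apply]

lemma tendsto_dotProduct_inv_mulVec {α : Type*} {l : Filter α} {k r : ℕ}
    {J₀ : Matrix (Fin k) (Fin r) ℝ} {S₀ : Matrix (Fin k) (Fin k) ℝ} {y₀ : Fin r → ℝ}
    (hinv : IsUnit (J₀ᵀ * S₀ * J₀).det) {J : α → Matrix (Fin k) (Fin r) ℝ}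
    {S : α → Matrix (Fin k) (Fin k) ℝ} {y : α → Fin r → ℝ} (hJ : Tendsto J l (𝓝 J₀))
    (hS : Tendsto S l (𝓝 S₀)) (hy : Tendsto y l (𝓝 y₀)) :
    Tendsto (fun a => y a ⬝ᵥ ((J a)ᵀ * S a * J a)⁻¹.mulVec (y a)) l
      (𝓝 (y₀ ⬝ᵥ (J₀ᵀ * S₀ * J₀)⁻¹.mulVec y₀)) := by
  have hA : Tendsto (fun a => (J a)ᵀ * S a * J a) l (𝓝 (J₀ᵀ * S₀ * J₀)) := by
    have hc : Continuous fun q : Matrix (Fin k) (Fin r) ℝ × Matrix (Fin k) (Fin k) ℝ =>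
        q.1ᵀ * q.2 * q.1 := by fun_prop
    have h := (hc.tendsto (J₀, S₀)).comp (hJ.prodMk_nhds hS)
    exact h
  have hAinv := (continuousAt_matrix_inv (J₀ᵀ * S₀ * J₀) (by
    simpa using continuousAt_inv₀ hinv.ne_zero)).tendsto.comp hA
  have hc : Continuous fun q : (Fin r → ℝ) × Matrix (Fin r) (Fin r) ℝ =>
      q.1 ⬝ᵥ q.2.mulVec q.1 := by
    fun_prop
  exact (hc.tendsto (y₀, (J₀ᵀ * S₀ * J₀)⁻¹)).comp (hy.prodMk_nhds hAinv)

lemma tendsto_waldStat {k r : ℕ} {θ₀ δ : Fin k → ℝ} {m : (Fin k → ℝ) → Fin r → ℝ}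
    (hm : ContDiff ℝ 1 m) (hm0 : m θ₀ = 0) {S₀ : Matrix (Fin k) (Fin k) ℝ}
    (hinv : IsUnit ((jacM m θ₀)ᵀ * S₀ * jacM m θ₀).det) {θstar : ℕ → Fin k → ℝ}
    (hθstar : Tendsto (fun n : ℕ => Real.sqrt n • (θstar n - θ₀)) atTop (𝓝 δ))
    (x : Fin k → ℝ) :
    Tendsto (fun p : (ℕ × (Fin k → Fin k → ℝ)) × (Fin k → ℝ) =>
        waldStat m p.1.1 (θstar p.1.1 + (Real.sqrt p.1.1)⁻¹ • p.2) p.1.2)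
      ((atTop ×ˢ 𝓝 (S₀ : Fin k → Fin k → ℝ)) ×ˢ 𝓝 x)
      (𝓝 ((jacM m θ₀)ᵀ.mulVec (δ + x) ⬝ᵥ
        ((jacM m θ₀)ᵀ * S₀ * jacM m θ₀)⁻¹.mulVec ((jacM m θ₀)ᵀ.mulVec (δ + x)))) := by
  set l := ((atTop : Filter ℕ) ×ˢ 𝓝 (S₀ : Fin k → Fin k → ℝ)) ×ˢ 𝓝 x with hl
  have hn : Tendsto (fun p : (ℕ × (Fin k → Fin k → ℝ)) × (Fin k → ℝ) => p.1.1) l atTop :=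
    tendsto_fst.comp tendsto_fst
  have hx : Tendsto (fun p : (ℕ × (Fin k → Fin k → ℝ)) × (Fin k → ℝ) => p.2) l (𝓝 x) :=
    tendsto_snd
  have hS : Tendsto (fun p : (ℕ × (Fin k → Fin k → ℝ)) × (Fin k → ℝ) =>
      (Matrix.of p.1.2 : Matrix (Fin k) (Fin k) ℝ)) l (𝓝 S₀) :=
    tendsto_snd.comp tendsto_fst
  have hsqrt : Tendsto (fun p : (ℕ × (Fin k → Fin k → ℝ)) × (Fin k → ℝ) => Real.sqrt p.1.1)
      l atTop := (Real.tendsto_sqrt_atTop.comp tendsto_natCast_atTop_atTop).comp hn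
  have hne : ∀ᶠ p in l, Real.sqrt p.1.1 ≠ 0 := hsqrt.eventually_ne_atTop 0
  set h : (ℕ × (Fin k → Fin k → ℝ)) × (Fin k → ℝ) → Fin k → ℝ :=
    fun p => (θstar p.1.1 - θ₀) + (Real.sqrt p.1.1)⁻¹ • p.2 with hh
  have hscaled : Tendsto (fun p => Real.sqrt p.1.1 • h p) l (𝓝 (δ + x)) := by
    refine ((hθstar.comp hn).add hx).congr' (hne.mono fun p hp => ?_)
    simp only [hh, Function.comp, smul_add, smul_smul, mul_inv_cancel₀ hp, one_smul]
  have hzero : Tendsto h l (𝓝 0) := by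
    have := (tendsto_inv_atTop_zero.comp hsqrt).smul hscaled
    rw [zero_smul] at this
    refine this.congr' (hne.mono fun p hp => ?_)
    simp only [Function.comp, smul_smul, inv_mul_cancel₀ hp, one_smul]
  have harg : ∀ p : (ℕ × (Fin k → Fin k → ℝ)) × (Fin k → ℝ),
      θstar p.1.1 + (Real.sqrt p.1.1)⁻¹ • p.2 = θ₀ + h p := by
    intro p
    simp only [hh]
    abel
  have hy : Tendsto (fun p => Real.sqrt p.1.1 • m (θ₀ + h p)) l
      (𝓝 ((jacM m θ₀)ᵀ.mulVec (δ + x))) := by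
    have hd := (hm.differentiable one_ne_zero θ₀).hasFDerivAt.hasFDerivWithinAt (s := Set.univ)
    have := hd.lim hzero (Eventually.of_forall fun _ => Set.mem_univ _) hscaled
    simpa only [hm0, sub_zero, jacM_transpose_mulVec] using this
  have hθ : Tendsto (fun p => θ₀ + h p) l (𝓝 θ₀) := by
    simpa using tendsto_const_nhds.add hzero
  have hJ : Tendsto (fun p => jacM m (θ₀ + h p)) l (𝓝 (jacM m θ₀)) :=
    ((continuous_jacM hm).tendsto θ₀).comp hθ
  refine (tendsto_dotProduct_inv_mulVec hinv hJ hS hy).congr fun p => ?_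
  simp only [waldStat, harg, mulVec_smul, smul_dotProduct, dotProduct_smul,
    smul_eq_mul, ← mul_assoc, Real.mul_self_sqrt (Nat.cast_nonneg p.1.1)]
  rfl

open scoped MatrixOrder in
lemma map_quadraticForm_mvNormal {k r : ℕ} (hr : 0 < r) {S : Matrix (Fin k) (Fin k) ℝ}
    (hS : S.PosDef) {ν : Measure (Fin k → ℝ)} (hν : IsMVNormal k S ν)
    {M : Matrix (Fin k) (Fin r) ℝ} (hinv : IsUnit (Mᵀ * S * M).det) (δ : Fin k → ℝ) :
    ν.map (fun x => Mᵀ.mulVec (δ + x) ⬝ᵥ (Mᵀ * S * M)⁻¹.mulVec (Mᵀ.mulVec (δ + x))) =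
      noncentralChiSq r (δ ⬝ᵥ (M * (Mᵀ * S * M)⁻¹ * Mᵀ).mulVec δ) := by
  obtain ⟨L, hL, rfl⟩ := hν
  set A := Mᵀ * S * M with hA
  have hApos : A.PosSemidef := by
    simpa [hA, conjTranspose_eq_transpose_of_trivial] using hS.posSemidef.conjTranspose_mul_mul_same M
  obtain ⟨R, hR⟩ : ∃ R : Matrix (Fin r) (Fin r) ℝ, A⁻¹ = Rᵀ * R := by
    obtain ⟨R, hR⟩ := CStarAlgebra.nonneg_iff_eq_star_mul_self.1 hApos.inv.nonneg
    exact ⟨R, by simpa [star_eq_conjTranspose, conjTranspose_eq_transpose_of_trivial] using hR⟩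
  have hform : ∀ y, Mᵀ.mulVec y ⬝ᵥ A⁻¹.mulVec (Mᵀ.mulVec y) =
      (R * Mᵀ).mulVec y ⬝ᵥ (R * Mᵀ).mulVec y := by
    intro y
    rw [hR, ← mulVec_mulVec, ← mulVec_mulVec, dotProduct_mulVec, vecMul_transpose]
  have hC : (R * Mᵀ * L) * (R * Mᵀ * L)ᵀ = 1 := by
    have h1 : Rᵀ * (R * A) = 1 := by
      rw [← Matrix.mul_assoc, ← hR, nonsing_inv_mul _ hinv]
    have h2 : R * A * Rᵀ = 1 := mul_eq_one_comm.1 h1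
    rw [← h2, hA, ← hL]
    simp only [transpose_mul, transpose_transpose, Matrix.mul_assoc]
  have hLm : Measurable L.mulVec :=
    (Continuous.matrix_mulVec continuous_const continuous_id).measurable
  have hCm : Measurable (R * Mᵀ * L).mulVec :=
    (Continuous.matrix_mulVec continuous_const continuous_id).measurable
  have hl : δ ⬝ᵥ (M * A⁻¹ * Mᵀ).mulVec δ =
      (R * Mᵀ).mulVec δ ⬝ᵥ (R * Mᵀ).mulVec δ := by
    rw [← hform, ← mulVec_mulVec, ← mulVec_mulVec, dotProduct_mulVec, mulVec_transpose]
  rw [hl, ← map_dotProduct_self_pi_gaussianReal hr, ← map_mulVec_pi_gaussianReal _ hC]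
  simp_rw [hform]
  have hq1 : Continuous fun x => (R * Mᵀ).mulVec (δ + x) ⬝ᵥ (R * Mᵀ).mulVec (δ + x) := by fun_prop
  have hq2 : Continuous fun u =>
    ((R * Mᵀ).mulVec δ + u) ⬝ᵥ ((R * Mᵀ).mulVec δ + u) := by fun_prop
  rw [Measure.map_map hq1.measurable hLm, Measure.map_map hq2.measurable hCm, stdGaussianPi]
  congr 1
  funext u
  simp only [Function.comp, mulVec_add, mulVec_mulVec]

/-- Asymptotic power expression under contaminated contiguous alternatives: the tail
probability of the Wald-type statistic converges to the Poisson mixture of central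
chi-square tail probabilities with mixing parameter `λ* = d_εᵀ N₀ d_ε`. -/
theorem wald_asymptotic_power_series
    (k r : ℕ) (hr : 1 ≤ r) (hrk : r ≤ k)
    (θ₀ d w : Fin k → ℝ) (ε : ℝ) (hε : 0 ≤ ε)
    (m : (Fin k → ℝ) → Fin r → ℝ) (hm : ContDiff ℝ 1 m) (hm0 : m θ₀ = 0)
    (S₀ : Matrix (Fin k) (Fin k) ℝ) (hS₀sym : S₀.IsSymm) (hS₀pd : S₀.PosDef)
    (hinv : IsUnit ((jacM m θ₀)ᵀ * S₀ * jacM m θ₀).det)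
    (θstar : ℕ → Fin k → ℝ)
    (hθstar : Tendsto (fun n : ℕ => Real.sqrt n • (θstar n - θ₀)) atTop (𝓝 (d + ε • w)))
    (Ω : ℕ → Type) [∀ n, MeasurableSpace (Ω n)]
    (P : ∀ n, Measure (Ω n)) [∀ n, IsProbabilityMeasure (P n)]
    (θhat : ∀ n, Ω n → Fin k → ℝ)
    (Sn : ∀ n, Ω n → Matrix (Fin k) (Fin k) ℝ)
    (hSsym : ∀ n ω, (Sn n ω).IsSymm)
    (hclt : ∃ ν : Measure (Fin k → ℝ), IsMVNormal k S₀ ν ∧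
      TendstoInDistribution P (fun n ω => Real.sqrt n • (θhat n ω - θstar n)) ν)
    (hScons : TendstoInProbability (E := Fin k → Fin k → ℝ) P (fun n ω => Sn n ω) S₀) :
    ∀ t : ℝ,
      Tendsto (fun n => P n {ω | t < waldStat m n (θhat n ω) (Sn n ω)}) atTop
        (𝓝 (∑' v : ℕ,
          ENNReal.ofReal
            (Real.exp (-((d + ε • w) ⬝ᵥ
                (jacM m θ₀ * ((jacM m θ₀)ᵀ * S₀ * jacM m θ₀)⁻¹ * (jacM m θ₀)ᵀ).mulVec
                  (d + ε • w)) / 2) *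
              (((d + ε • w) ⬝ᵥ
                (jacM m θ₀ * ((jacM m θ₀)ᵀ * S₀ * jacM m θ₀)⁻¹ * (jacM m θ₀)ᵀ).mulVec
                  (d + ε • w)) / 2) ^ v / (Nat.factorial v)) *
            chiSq (r + 2 * v) (Set.Ioi t))) := by
  intro t
  obtain ⟨ν, hν, hlim⟩ := hclt
  have hprob : IsProbabilityMeasure ν := by
    obtain ⟨L, -, rfl⟩ := hν
    have : IsProbabilityMeasure (stdGaussianPi k) := by
      unfold stdGaussianPi
      infer_instance
    exact Measure.isProbabilityMeasure_map
      (Continuous.matrix_mulVec continuous_const continuous_id).measurable.aemeasurable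
  have hlaw := map_quadraticForm_mvNormal (by omega) hS₀pd hν hinv (d + ε • w)
  have hconv := tendsto_measure_gt_of_continuous_convergence hlim hScons
    (G := fun n x s => waldStat m n (θstar n + (Real.sqrt n)⁻¹ • x) s) (t := t)
    (by fun_prop) (tendsto_waldStat hm hm0 hinv hθstar)
    (by rw [hlaw]; exact noncentralChiSq_singleton _ _ _)
  rw [hlaw, noncentralChiSq, Measure.sum_apply _ measurableSet_Ioi] at hconv
  simp only [Measure.smul_apply, smul_eq_mul] at hconv
  refine hconv.congr' ?_
  filter_upwards [eventually_ge_atTop 1] with n hn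
  have hne : Real.sqrt n ≠ 0 := (Real.sqrt_pos.2 (by exact_mod_cast hn)).ne'
  simp only [smul_smul, inv_mul_cancel₀ hne, one_smul, add_sub_cancel]
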